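/- arXiv:2307.01518 — 6 statements merged into one kernel-verified Lean document; each statement's English description precedes it below -/
import Mathlib

section
/- (Energy identity, Theorem 1.) For every t ∈ [0,T], E(t) + ∫₀^t ∫₀^ℓ μ(x) u_τ(x,τ)² dx dτ = E(0) − k_a⁻ ∫₀^t u_{xτ}(0,τ)² dτ − k_a⁺ ∫₀^t u_{xτ}(ℓ,τ)² dτ. -/
open Set intervalIntegral

noncomputable def pdx (u : ℝ → ℝ → ℝ) (x t : ℝ) : ℝ := deriv (fun y => u y t) x
noncomputable def pdt (u : ℝ → ℝ → ℝ) (x t : ℝ) : ℝ := deriv (fun s => u x s) t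

noncomputable def beamEnergy (m r : ℝ → ℝ) (krm krp ℓ : ℝ) (u : ℝ → ℝ → ℝ) (t : ℝ) : ℝ :=
  (1/2) * (∫ x in (0:ℝ)..ℓ, (m x * (pdt u x t)^2 + r x * (pdx (pdx u) x t)^2))
    + (1/2) * krm * (pdx u 0 t)^2 + (1/2) * krp * (pdx u ℓ t)^2

theorem hasDerivAt_pdx {f : ℝ → ℝ → ℝ} (hf : ContDiff ℝ (⊤ : ℕ∞) (Function.uncurry f))
    (x t : ℝ) : HasDerivAt (fun y => f y t) (pdx f x t) x := by
  have h : ContDiff ℝ (⊤ : ℕ∞) (fun y : ℝ => Function.uncurry f (y, t)) := by fun_prop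
  exact (h.differentiable (by simp) x).hasDerivAt

theorem hasDerivAt_pdt {f : ℝ → ℝ → ℝ} (hf : ContDiff ℝ (⊤ : ℕ∞) (Function.uncurry f))
    (x t : ℝ) : HasDerivAt (fun s => f x s) (pdt f x t) t := by
  have h : ContDiff ℝ (⊤ : ℕ∞) (fun s : ℝ => Function.uncurry f (x, s)) := by fun_prop
  exact (h.differentiable (by simp) t).hasDerivAt

theorem pdx_eq_fderiv {f : ℝ → ℝ → ℝ} (hf : Differentiable ℝ (Function.uncurry f)) (x t : ℝ) :
    pdx f x t = fderiv ℝ (Function.uncurry f) (x, t) (1, 0) :=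
  ((hf (x, t)).hasFDerivAt.comp_hasDerivAt (f := fun y => (y, t)) x
    ((hasDerivAt_id x).prodMk (hasDerivAt_const x t))).deriv

theorem pdt_eq_fderiv {f : ℝ → ℝ → ℝ} (hf : Differentiable ℝ (Function.uncurry f)) (x t : ℝ) :
    pdt f x t = fderiv ℝ (Function.uncurry f) (x, t) (0, 1) :=
  ((hf (x, t)).hasFDerivAt.comp_hasDerivAt (f := fun s => (x, s)) t
    ((hasDerivAt_const t x).prodMk (hasDerivAt_id t))).deriv

theorem uncurry_pdx {f : ℝ → ℝ → ℝ} (hf : ContDiff ℝ (⊤ : ℕ∞) (Function.uncurry f)) :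
    Function.uncurry (pdx f) = fun p => fderiv ℝ (Function.uncurry f) p (1, 0) :=
  funext fun p => pdx_eq_fderiv (hf.differentiable (by simp)) p.1 p.2

theorem uncurry_pdt {f : ℝ → ℝ → ℝ} (hf : ContDiff ℝ (⊤ : ℕ∞) (Function.uncurry f)) :
    Function.uncurry (pdt f) = fun p => fderiv ℝ (Function.uncurry f) p (0, 1) :=
  funext fun p => pdt_eq_fderiv (hf.differentiable (by simp)) p.1 p.2

theorem contDiff_pdx {f : ℝ → ℝ → ℝ} (hf : ContDiff ℝ (⊤ : ℕ∞) (Function.uncurry f)) :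
    ContDiff ℝ (⊤ : ℕ∞) (Function.uncurry (pdx f)) := by
  rw [uncurry_pdx hf]
  exact (hf.fderiv_right (by simp)).clm_apply contDiff_const

theorem contDiff_pdt {f : ℝ → ℝ → ℝ} (hf : ContDiff ℝ (⊤ : ℕ∞) (Function.uncurry f)) :
    ContDiff ℝ (⊤ : ℕ∞) (Function.uncurry (pdt f)) := by
  rw [uncurry_pdt hf]
  exact (hf.fderiv_right (by simp)).clm_apply contDiff_const

theorem pdt_pdx_comm {f : ℝ → ℝ → ℝ} (hf : ContDiff ℝ (⊤ : ℕ∞) (Function.uncurry f)) :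
    pdt (pdx f) = pdx (pdt f) := by
  funext x t
  have hd : DifferentiableAt ℝ (fderiv ℝ (Function.uncurry f)) (x, t) :=
    (hf.fderiv_right (m := 1) (by norm_cast)).differentiable (by simp) _
  rw [pdt_eq_fderiv ((contDiff_pdx hf).differentiable (by simp)),
    pdx_eq_fderiv ((contDiff_pdt hf).differentiable (by simp)), uncurry_pdx hf, uncurry_pdt hf,
    fderiv_clm_apply hd (differentiableAt_const _), fderiv_clm_apply hd (differentiableAt_const _)]
  have hs : IsSymmSndFDerivAt ℝ (Function.uncurry f) (x, t) :=
    hf.contDiffAt.isSymmSndFDerivAt (by simp; norm_cast)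
  simpa using hs.eq (0, 1) (1, 0)

/-- Integrating in time the time derivative of a spatial integral. -/
theorem integral_integral_deriv_time {G G' : ℝ → ℝ → ℝ}
    (hG : Continuous (Function.uncurry G)) (hG' : Continuous (Function.uncurry G'))
    (hd : ∀ x t, HasDerivAt (G x) (G' x t) t) (a b s t : ℝ) :
    ∫ τ in s..t, ∫ x in a..b, G' x τ = (∫ x in a..b, G x t) - ∫ x in a..b, G x s := by
  have hi : MeasureTheory.IntegrableOn (Function.uncurry G') (uIoc a b ×ˢ uIoc s t) :=
    (hG'.continuousOn.integrableOn_compact (isCompact_uIcc.prod isCompact_uIcc)).mono_set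
      (prod_mono uIoc_subset_uIcc uIoc_subset_uIcc)
  have hc (t : ℝ) : Continuous fun x => G x t := by fun_prop
  rw [← MeasureTheory.intervalIntegral_intervalIntegral_swap hi,
    ← integral_sub ((hc t).intervalIntegrable _ _) ((hc s).intervalIntegrable _ _)]
  refine integral_congr fun x _ => integral_eq_sub_of_hasDerivAt (fun τ _ => hd x τ) ?_
  exact Continuous.intervalIntegrable (by fun_prop) _ _

/-- The second-order Green identity in the space variable. -/
theorem integral_mul_pdx_pdx_sub {f g : ℝ → ℝ → ℝ}
    (hf : ContDiff ℝ (⊤ : ℕ∞) (Function.uncurry f)) (hg : ContDiff ℝ (⊤ : ℕ∞) (Function.uncurry g))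
    (a b t : ℝ) :
    ∫ x in a..b, (f x t * pdx (pdx g) x t - g x t * pdx (pdx f) x t)
      = (f b t * pdx g b t - pdx f b t * g b t) - (f a t * pdx g a t - pdx f a t * g a t) := by
  have hf0 := hf.continuous
  have hg0 := hg.continuous
  have hf2 := (contDiff_pdx (contDiff_pdx hf)).continuous
  have hg2 := (contDiff_pdx (contDiff_pdx hg)).continuous
  refine integral_eq_sub_of_hasDerivAt
    (f := fun x => f x t * pdx g x t - pdx f x t * g x t) (fun x _ => ?_)
    (Continuous.intervalIntegrable (by fun_prop) _ _)
  refine (((hasDerivAt_pdx hf x t).mul (hasDerivAt_pdx (contDiff_pdx hg) x t)).sub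
    ((hasDerivAt_pdx (contDiff_pdx hf) x t).mul (hasDerivAt_pdx hg x t))).congr_deriv ?_
  ring

theorem pdt_eq_zero_of_eqOn {f : ℝ → ℝ → ℝ} {x T t : ℝ} (h : ∀ s ∈ Icc 0 T, f x s = 0)
    (ht : t ∈ Ioo 0 T) : pdt f x t = 0 := by
  have : (fun s => f x s) =ᶠ[nhds t] fun _ => 0 := by
    filter_upwards [Ioo_mem_nhds ht.1 ht.2] with s hs using h s (Ioo_subset_Icc_self hs)
  rw [pdt, this.deriv_eq, deriv_const]

theorem integral_mul_pdt {f : ℝ → ℝ → ℝ} (hf : ContDiff ℝ (⊤ : ℕ∞) (Function.uncurry f))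
    (x s t : ℝ) :
    ∫ τ in s..t, f x τ * pdt f x τ = ((f x t) ^ 2 - (f x s) ^ 2) / 2 := by
  have hf0 := hf.continuous
  have hf1 := (contDiff_pdt hf).continuous
  rw [integral_eq_sub_of_hasDerivAt (f := fun τ => (f x τ) ^ 2 / 2) (fun τ _ => ?_)
    (Continuous.intervalIntegrable (by fun_prop) _ _)]
  · ring
  · refine (((hasDerivAt_pdt hf x τ).pow 2).div_const 2).congr_deriv ?_
    push_cast
    ring

theorem energy_identity
    (ℓ T m₀ m₁ μ₀ μ₁ r₀ r₁ krm kam krp kap : ℝ)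
    (m μ r : ℝ → ℝ) (u : ℝ → ℝ → ℝ)
    (hℓ : 0 < ℓ) (hT : 0 < T)
    (hm₀ : 0 < m₀) (hμ₀ : 0 ≤ μ₀) (hr₀ : 0 < r₀)
    (hmc : ContinuousOn m (Icc 0 ℓ)) (hμc : ContinuousOn μ (Icc 0 ℓ))
    (hrc : ContinuousOn r (Icc 0 ℓ))
    (hmb : ∀ x ∈ Icc 0 ℓ, m₀ ≤ m x ∧ m x ≤ m₁)
    (hμb : ∀ x ∈ Icc 0 ℓ, μ₀ ≤ μ x ∧ μ x ≤ μ₁)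
    (hrb : ∀ x ∈ Icc 0 ℓ, r₀ ≤ r x ∧ r x ≤ r₁)
    (hkrm : 0 ≤ krm) (hkam : 0 ≤ kam) (hkrp : 0 ≤ krp) (hkap : 0 ≤ kap)
    (hu : ContDiff ℝ (⊤ : ℕ∞) (Function.uncurry u))
    (hq : ContDiff ℝ (⊤ : ℕ∞) (Function.uncurry (fun x t => r x * pdx (pdx u) x t)))
    (hpde : ∀ x ∈ Ioo 0 ℓ, ∀ t ∈ Ioo 0 T,
      m x * pdt (pdt u) x t + μ x * pdt u x t
        + pdx (pdx (fun y s => r y * pdx (pdx u) y s)) x t = 0)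
    (hbu0 : ∀ t ∈ Icc 0 T, u 0 t = 0)
    (hbuℓ : ∀ t ∈ Icc 0 T, u ℓ t = 0)
    (hbm0 : ∀ t ∈ Icc 0 T,
      -(r 0 * pdx (pdx u) 0 t) = -(krm * pdx u 0 t) - kam * pdt (pdx u) 0 t)
    (hbmℓ : ∀ t ∈ Icc 0 T,
      -(r ℓ * pdx (pdx u) ℓ t) = krp * pdx u ℓ t + kap * pdt (pdx u) ℓ t) :
    ∀ t ∈ Icc 0 T,
      beamEnergy m r krm krp ℓ u t + (∫ τ in (0:ℝ)..t, ∫ x in (0:ℝ)..ℓ, μ x * (pdt u x τ)^2)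
        = beamEnergy m r krm krp ℓ u 0 - kam * (∫ τ in (0:ℝ)..t, (pdt (pdx u) 0 τ)^2)
            - kap * (∫ τ in (0:ℝ)..t, (pdt (pdx u) ℓ τ)^2) := by
  obtain ⟨M, hM, hMm⟩ : ∃ M : ℝ → ℝ, Continuous M ∧ EqOn m M (Icc 0 ℓ) :=
    ⟨IccExtend hℓ.le ((Icc 0 ℓ).domRestrict m), hmc.domRestrict.Icc_extend',
      fun x hx => (IccExtend_of_mem hℓ.le ((Icc 0 ℓ).domRestrict m) hx).symm⟩
  obtain ⟨N, hN, hNμ⟩ : ∃ N : ℝ → ℝ, Continuous N ∧ EqOn μ N (Icc 0 ℓ) :=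
    ⟨IccExtend hℓ.le ((Icc 0 ℓ).domRestrict μ), hμc.domRestrict.Icc_extend',
      fun x hx => (IccExtend_of_mem hℓ.le ((Icc 0 ℓ).domRestrict μ) hx).symm⟩
  set q : ℝ → ℝ → ℝ := fun x t => r x * pdx (pdx u) x t with hq_def
  have hut := contDiff_pdt hu
  have hux := contDiff_pdx hu
  have huxx := contDiff_pdx hux
  have hutxx := contDiff_pdx (contDiff_pdx hut)
  have hcomm : pdt (pdx (pdx u)) = pdx (pdx (pdt u)) := by
    rw [pdt_pdx_comm hux, pdt_pdx_comm hu]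
  have hq0 := hq.continuous
  have hut0 := hut.continuous
  have huxx0 := huxx.continuous
  have hutt0 := (contDiff_pdt hut).continuous
  have hutxx0 := hutxx.continuous
  have hux0 := hux.continuous
  have huxt0 := (contDiff_pdt hux).continuous
  have hqxx0 := (contDiff_pdx (contDiff_pdx hq)).continuous
  have henergy (t : ℝ) : ∫ x in (0:ℝ)..ℓ, (m x * (pdt u x t)^2 + r x * (pdx (pdx u) x t)^2)
      = ∫ x in (0:ℝ)..ℓ, (M x * (pdt u x t)^2 + q x t * pdx (pdx u) x t) := by
    refine integral_congr fun x hx => ?_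
    rw [uIcc_of_le hℓ.le] at hx
    simp only [hMm hx, hq_def]
    ring
  have hdiss (t : ℝ) : ∫ x in (0:ℝ)..ℓ, μ x * (pdt u x t)^2
      = ∫ x in (0:ℝ)..ℓ, N x * (pdt u x t)^2 := by
    refine integral_congr fun x hx => ?_
    rw [uIcc_of_le hℓ.le] at hx
    simp only [hNμ hx]
  intro t ht
  have hbalance := integral_integral_deriv_time
    (G := fun x t => M x * (pdt u x t)^2 + q x t * pdx (pdx u) x t)
    (G' := fun x t => 2 * (M x * pdt u x t * pdt (pdt u) x t + q x t * pdx (pdx (pdt u)) x t))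
    (by fun_prop) (by fun_prop)
    (fun x t => by
      have hw := hasDerivAt_pdt huxx x t
      rw [hcomm] at hw
      refine ((((hasDerivAt_pdt hut x t).pow 2).const_mul (M x)).add
        ((hw.const_mul (r x)).mul hw)).congr_deriv ?_
      simp only [hq_def]
      push_cast
      ring)
    0 ℓ 0 t
  have hpower : ∀ τ ∈ Ioo 0 t,
      ∫ x in (0:ℝ)..ℓ,
          2 * (M x * pdt u x τ * pdt (pdt u) x τ + q x τ * pdx (pdx (pdt u)) x τ)
        = -2 * (∫ x in (0:ℝ)..ℓ, N x * (pdt u x τ)^2)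
          - 2 * krm * (pdx u 0 τ * pdt (pdx u) 0 τ) - 2 * krp * (pdx u ℓ τ * pdt (pdx u) ℓ τ)
          - 2 * kam * (pdt (pdx u) 0 τ)^2 - 2 * kap * (pdt (pdx u) ℓ τ)^2 := by
    intro τ hτ
    have hτT : τ ∈ Ioo 0 T := ⟨hτ.1, hτ.2.trans_le ht.2⟩
    have hgreen := integral_mul_pdx_pdx_sub hut hq 0 ℓ τ
    rw [pdt_eq_zero_of_eqOn hbu0 hτT, pdt_eq_zero_of_eqOn hbuℓ hτT, ← pdt_pdx_comm hu] at hgreen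
    have h0 := hbm0 τ (Ioo_subset_Icc_self hτT)
    have hl := hbmℓ τ (Ioo_subset_Icc_self hτT)
    change -(q 0 τ) = _ at h0
    change -(q ℓ τ) = _ at hl
    have hsplit : ∫ x in (0:ℝ)..ℓ,
          2 * (M x * pdt u x τ * pdt (pdt u) x τ + q x τ * pdx (pdx (pdt u)) x τ)
        = ∫ x in (0:ℝ)..ℓ, (-2 * (N x * (pdt u x τ)^2)
          - 2 * (pdt u x τ * pdx (pdx q) x τ - q x τ * pdx (pdx (pdt u)) x τ)) := by
      refine integral_congr_Ioo_of_le hℓ.le fun x hx => ?_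
      have hp := hpde x hx τ hτT
      rw [hMm (Ioo_subset_Icc_self hx), hNμ (Ioo_subset_Icc_self hx)] at hp
      linear_combination 2 * pdt u x τ * hp
    rw [hsplit, integral_sub (Continuous.intervalIntegrable (by fun_prop) _ _)
      (Continuous.intervalIntegrable (by fun_prop) _ _), integral_const_mul, integral_const_mul]
    rw [← pdt_pdx_comm hu, hgreen]
    linear_combination 2 * pdt (pdx u) 0 τ * h0 - 2 * pdt (pdx u) ℓ τ * hl
  rw [integral_congr_Ioo_of_le ht.1 hpower] at hbalance
  have hN0 : Continuous fun τ => ∫ x in (0:ℝ)..ℓ, N x * (pdt u x τ)^2 :=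
    continuous_parametric_intervalIntegral_of_continuous'
      (f := fun τ x => N x * (pdt u x τ)^2) (by fun_prop) 0 ℓ
  rw [integral_sub (Continuous.intervalIntegrable (by fun_prop) _ _)
      (Continuous.intervalIntegrable (by fun_prop) _ _),
    integral_sub (Continuous.intervalIntegrable (by fun_prop) _ _)
      (Continuous.intervalIntegrable (by fun_prop) _ _),
    integral_sub (Continuous.intervalIntegrable (by fun_prop) _ _)
      (Continuous.intervalIntegrable (by fun_prop) _ _),
    integral_sub (Continuous.intervalIntegrable (by fun_prop) _ _)
      (Continuous.intervalIntegrable (by fun_prop) _ _),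
    integral_const_mul, integral_const_mul, integral_const_mul, integral_const_mul,
    integral_const_mul, integral_mul_pdt hux, integral_mul_pdt hux] at hbalance
  simp only [beamEnergy, henergy, hdiss]
  linear_combination -hbalance / 2
end

section
/- (Lemma 3: two-sided bound of the auxiliary function by the energy.) Let β₀ = (ℓ²/2)√(m₁/r₀) and β₁ = β₀ · (1 + (1/√(m₁ r₀)) · (ℓ² μ₁ + (2/ℓ)(k_a⁻ + k_a⁺))). Then for every t ∈ [0,T], −β₀ E(t) ≤ J(t) ≤ β₁ E(t). -/
open Set intervalIntegral

noncomputable def beamJ (m μ : ℝ → ℝ) (kam kap ℓ : ℝ) (u : ℝ → ℝ → ℝ) (t : ℝ) : ℝ :=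
  (∫ x in (0:ℝ)..ℓ, m x * u x t * pdt u x t)
    + (1/2) * (∫ x in (0:ℝ)..ℓ, μ x * (u x t)^2)
    + (1/2) * kam * (pdx u 0 t)^2 + (1/2) * kap * (pdx u ℓ t)^2

theorem sq_integral_mul_le_of_continuous {a b : ℝ} (hab : a ≤ b) {f g : ℝ → ℝ}
    (hf : Continuous f) (hg : Continuous g) :
    (∫ x in a..b, f x * g x) ^ 2 ≤ (∫ x in a..b, f x ^ 2) * ∫ x in a..b, g x ^ 2 := by
  have key : ∀ s : ℝ, 0 ≤ (∫ x in a..b, g x ^ 2) * (s * s)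
      + (2 * ∫ x in a..b, f x * g x) * s + ∫ x in a..b, f x ^ 2 := by
    intro s
    have h0 : 0 ≤ ∫ x in a..b, (f x + s * g x) ^ 2 :=
      integral_nonneg hab fun x _ => sq_nonneg _
    have h1 : (∫ x in a..b, (f x + s * g x) ^ 2)
        = ∫ x in a..b, ((s * s) * g x ^ 2 + (2 * s) * (f x * g x) + f x ^ 2) := by
      congr 1; ext x; ring
    rw [h1, integral_add (Continuous.intervalIntegrable (by fun_prop) _ _)
        (Continuous.intervalIntegrable (by fun_prop) _ _),
      integral_add (Continuous.intervalIntegrable (by fun_prop) _ _)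
        (Continuous.intervalIntegrable (by fun_prop) _ _),
      integral_const_mul, integral_const_mul] at h0
    linarith
  have := discrim_le_zero key
  unfold discrim at this
  nlinarith

theorem integral_sq_le_of_zero_left {ℓ : ℝ} (hℓ : 0 ≤ ℓ) {f f' : ℝ → ℝ}
    (hf : ∀ x, HasDerivAt f (f' x) x) (hf' : Continuous f') (h0 : f 0 = 0) :
    (∫ x in (0 : ℝ)..ℓ, f x ^ 2) ≤ ℓ ^ 2 / 2 * ∫ x in (0 : ℝ)..ℓ, f' x ^ 2 := by
  have hfc : Continuous f := continuous_iff_continuousAt.2 fun x => (hf x).continuousAt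
  have hpt : ∀ x ∈ Icc 0 ℓ, f x ^ 2 ≤ x * ∫ y in (0 : ℝ)..ℓ, f' y ^ 2 := by
    intro x hx
    have h1 : (∫ y in (0 : ℝ)..x, f' y) = f x := by
      rw [integral_eq_sub_of_hasDerivAt (fun y _ => hf y) (hf'.intervalIntegrable _ _), h0,
        sub_zero]
    have h2 := sq_integral_mul_le_of_continuous hx.1 (continuous_const (y := (1 : ℝ))) hf'
    simp only [one_mul, one_pow, integral_const, sub_zero, smul_eq_mul, mul_one, h1] at h2
    refine h2.trans (mul_le_mul_of_nonneg_left ?_ hx.1)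
    exact integral_mono_interval le_rfl hx.1 hx.2
      (Filter.Eventually.of_forall fun y => sq_nonneg _)
      ((hf'.pow 2).intervalIntegrable _ _)
  calc (∫ x in (0 : ℝ)..ℓ, f x ^ 2)
      ≤ ∫ x in (0 : ℝ)..ℓ, x * ∫ y in (0 : ℝ)..ℓ, f' y ^ 2 :=
        integral_mono_on hℓ ((hfc.pow 2).intervalIntegrable _ _)
          (Continuous.intervalIntegrable (by fun_prop) _ _) hpt
    _ = ℓ ^ 2 / 2 * ∫ x in (0 : ℝ)..ℓ, f' x ^ 2 := by
        rw [integral_mul_const, integral_id]; ring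

theorem integral_sq_le_integral_sq_second_deriv {ℓ : ℝ} (hℓ : 0 ≤ ℓ) {f f' f'' : ℝ → ℝ}
    (hf : ∀ x, HasDerivAt f (f' x) x) (hf' : ∀ x, HasDerivAt f' (f'' x) x)
    (hf'' : Continuous f'') (h0 : f 0 = 0) (h1 : f ℓ = 0) :
    (∫ x in (0 : ℝ)..ℓ, f x ^ 2) ≤ ℓ ^ 4 / 4 * ∫ x in (0 : ℝ)..ℓ, f'' x ^ 2 := by
  have hfc : Continuous f := continuous_iff_continuousAt.2 fun x => (hf x).continuousAt
  have hfc' : Continuous f' := continuous_iff_continuousAt.2 fun x => (hf' x).continuousAt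
  have hAB := integral_sq_le_of_zero_left hℓ hf hfc' h0
  have hparts : (∫ x in (0 : ℝ)..ℓ, f x * f'' x) = -∫ x in (0 : ℝ)..ℓ, f' x ^ 2 := by
    rw [integral_mul_deriv_eq_deriv_mul (fun x _ => hf x) (fun x _ => hf' x)
      (hfc'.intervalIntegrable _ _) (hf''.intervalIntegrable _ _), h0, h1]
    simp [sq]
  have hcs := sq_integral_mul_le_of_continuous hℓ hfc hf''
  rw [hparts, neg_sq] at hcs
  have hA : 0 ≤ ∫ x in (0 : ℝ)..ℓ, f x ^ 2 := integral_nonneg hℓ fun x _ => sq_nonneg _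
  have hC : 0 ≤ ∫ x in (0 : ℝ)..ℓ, f'' x ^ 2 := integral_nonneg hℓ fun x _ => sq_nonneg _
  generalize (∫ x in (0 : ℝ)..ℓ, f x ^ 2) = A at *
  generalize (∫ x in (0 : ℝ)..ℓ, f' x ^ 2) = B at *
  generalize (∫ x in (0 : ℝ)..ℓ, f'' x ^ 2) = C at *
  rcases hA.eq_or_lt with hA0 | hA0
  · rw [← hA0]; positivity
  · have h2 : A ^ 2 ≤ (ℓ ^ 2 / 2 * B) ^ 2 := pow_le_pow_left₀ hA hAB 2
    have h3 : (ℓ ^ 2 / 2 * B) ^ 2 ≤ ℓ ^ 4 / 4 * (A * C) := by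
      calc (ℓ ^ 2 / 2 * B) ^ 2 = ℓ ^ 4 / 4 * B ^ 2 := by ring
        _ ≤ _ := mul_le_mul_of_nonneg_left hcs (by positivity)
    refine le_of_mul_le_mul_left ?_ hA0
    linarith

theorem sq_deriv_left_le {ℓ : ℝ} (hℓ : 0 < ℓ) {f f' f'' : ℝ → ℝ}
    (hf : ∀ x, HasDerivAt f (f' x) x) (hf' : ∀ x, HasDerivAt f' (f'' x) x)
    (hf'' : Continuous f'') (h0 : f 0 = 0) (h1 : f ℓ = 0) :
    f' 0 ^ 2 ≤ ℓ * ∫ x in (0 : ℝ)..ℓ, f'' x ^ 2 := by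
  have hfc' : Continuous f' := continuous_iff_continuousAt.2 fun x => (hf' x).continuousAt
  have hparts : (∫ x in (0 : ℝ)..ℓ, (ℓ - x) * f'' x) = -(ℓ * f' 0) := by
    rw [integral_mul_deriv_eq_deriv_mul (u := fun x => ℓ - x) (u' := fun _ => -1)
      (fun x _ => (hasDerivAt_id x).const_sub ℓ) (fun x _ => hf' x)
      intervalIntegrable_const (hf''.intervalIntegrable _ _), integral_const_mul,
      integral_eq_sub_of_hasDerivAt (fun x _ => hf x) (hfc'.intervalIntegrable _ _), h0, h1]
    ring
  have hcs := sq_integral_mul_le_of_continuous hℓ.le (f := fun x => ℓ - x) (by fun_prop) hf''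
  have hw : (∫ x in (0 : ℝ)..ℓ, (ℓ - x) ^ 2) = ℓ ^ 3 / 3 := by
    rw [integral_comp_sub_left (fun x => x ^ 2) ℓ, integral_pow]; norm_num
  rw [hparts, hw] at hcs
  have hC : 0 ≤ ∫ x in (0 : ℝ)..ℓ, f'' x ^ 2 := integral_nonneg hℓ.le fun x _ => sq_nonneg _
  refine le_of_mul_le_mul_left ?_ (pow_pos hℓ 2)
  nlinarith [mul_nonneg (pow_pos hℓ 3).le hC]

theorem sq_deriv_right_le {ℓ : ℝ} (hℓ : 0 < ℓ) {f f' f'' : ℝ → ℝ}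
    (hf : ∀ x, HasDerivAt f (f' x) x) (hf' : ∀ x, HasDerivAt f' (f'' x) x)
    (hf'' : Continuous f'') (h0 : f 0 = 0) (h1 : f ℓ = 0) :
    f' ℓ ^ 2 ≤ ℓ * ∫ x in (0 : ℝ)..ℓ, f'' x ^ 2 := by
  have hrefl : ∀ x, HasDerivAt (fun y => ℓ - y) (-1 : ℝ) x := fun x =>
    (hasDerivAt_id x).const_sub ℓ
  have h := sq_deriv_left_le hℓ (f := fun x => f (ℓ - x)) (f' := fun x => -f' (ℓ - x))
    (f'' := fun x => f'' (ℓ - x))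
    (fun x => ((hf (ℓ - x)).comp x (hrefl x)).congr_deriv (by ring))
    (fun x => ((hf' (ℓ - x)).comp x (hrefl x)).neg.congr_deriv (by ring))
    (by fun_prop) (by simpa using h1) (by simpa using h0)
  rw [integral_comp_sub_left (fun x => f'' x ^ 2) ℓ] at h
  simpa using h

theorem abs_integral_weight_mul_le {ℓ m₁ β : ℝ} (hℓ : 0 ≤ ℓ) (hβ : 0 < β) {m f g : ℝ → ℝ}
    (hm : ContinuousOn m (Icc 0 ℓ)) (hmb : ∀ x ∈ Icc 0 ℓ, 0 ≤ m x ∧ m x ≤ m₁)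
    (hf : Continuous f) (hg : Continuous g) :
    |∫ x in (0 : ℝ)..ℓ, m x * f x * g x|
      ≤ β / 2 * (∫ x in (0 : ℝ)..ℓ, m x * g x ^ 2)
        + m₁ / (2 * β) * ∫ x in (0 : ℝ)..ℓ, f x ^ 2 := by
  have hu : uIcc 0 ℓ = Icc 0 ℓ := uIcc_of_le hℓ
  have hi : IntervalIntegrable (fun x => m x * g x ^ 2) MeasureTheory.volume 0 ℓ :=
    (hu ▸ hm.mul (hg.pow 2).continuousOn : ContinuousOn _ (uIcc 0 ℓ)).intervalIntegrable
  have hj : IntervalIntegrable (fun x => m x * f x * g x) MeasureTheory.volume 0 ℓ :=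
    (hu ▸ (hm.mul hf.continuousOn).mul hg.continuousOn :
      ContinuousOn _ (uIcc 0 ℓ)).intervalIntegrable
  have hk : IntervalIntegrable (fun x => f x ^ 2) MeasureTheory.volume 0 ℓ :=
    (hf.pow 2).intervalIntegrable _ _
  rw [← integral_const_mul, ← integral_const_mul,
    ← integral_add (hi.const_mul _) (hk.const_mul _)]
  refine (abs_integral_le_integral_abs hℓ).trans
    (integral_mono_on hℓ hj.abs ((hi.const_mul _).add (hk.const_mul _)) fun x hx => ?_)
  obtain ⟨hm0, hm1⟩ := hmb x hx
  have hyoung : |f x * g x| ≤ β / 2 * g x ^ 2 + 1 / (2 * β) * f x ^ 2 := by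
    have h1 : β / 2 * g x ^ 2 + 1 / (2 * β) * f x ^ 2 - f x * g x
        = (β * g x - f x) ^ 2 / (2 * β) := by field_simp; ring
    have h2 : β / 2 * g x ^ 2 + 1 / (2 * β) * f x ^ 2 + f x * g x
        = (β * g x + f x) ^ 2 / (2 * β) := by field_simp; ring
    have h3 : 0 ≤ (β * g x - f x) ^ 2 / (2 * β) := by positivity
    have h4 : 0 ≤ (β * g x + f x) ^ 2 / (2 * β) := by positivity
    rw [abs_le]; constructor <;> linarith
  calc |m x * f x * g x| = m x * |f x * g x| := by rw [mul_assoc, abs_mul, abs_of_nonneg hm0]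
    _ ≤ m x * (β / 2 * g x ^ 2 + 1 / (2 * β) * f x ^ 2) := mul_le_mul_of_nonneg_left hyoung hm0
    _ = β / 2 * (m x * g x ^ 2) + 1 / (2 * β) * f x ^ 2 * m x := by ring
    _ ≤ β / 2 * (m x * g x ^ 2) + 1 / (2 * β) * f x ^ 2 * m₁ := by gcongr
    _ = β / 2 * (m x * g x ^ 2) + m₁ / (2 * β) * f x ^ 2 := by ring

theorem auxiliary_function_two_sided_bound
    (ℓ T m₀ m₁ μ₀ μ₁ r₀ r₁ krm kam krp kap : ℝ)
    (m μ r : ℝ → ℝ) (u : ℝ → ℝ → ℝ)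
    (hℓ : 0 < ℓ) (hT : 0 < T)
    (hm₀ : 0 < m₀) (hμ₀ : 0 ≤ μ₀) (hr₀ : 0 < r₀)
    (hmc : ContinuousOn m (Icc 0 ℓ)) (hμc : ContinuousOn μ (Icc 0 ℓ))
    (hrc : ContinuousOn r (Icc 0 ℓ))
    (hmb : ∀ x ∈ Icc 0 ℓ, m₀ ≤ m x ∧ m x ≤ m₁)
    (hμb : ∀ x ∈ Icc 0 ℓ, μ₀ ≤ μ x ∧ μ x ≤ μ₁)
    (hrb : ∀ x ∈ Icc 0 ℓ, r₀ ≤ r x ∧ r x ≤ r₁)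
    (hkrm : 0 ≤ krm) (hkam : 0 ≤ kam) (hkrp : 0 ≤ krp) (hkap : 0 ≤ kap)
    (hu : ContDiff ℝ (⊤ : ℕ∞) (Function.uncurry u))
    (hq : ContDiff ℝ (⊤ : ℕ∞) (Function.uncurry (fun x t => r x * pdx (pdx u) x t)))
    (hpde : ∀ x ∈ Ioo 0 ℓ, ∀ t ∈ Ioo 0 T,
      m x * pdt (pdt u) x t + μ x * pdt u x t
        + pdx (pdx (fun y s => r y * pdx (pdx u) y s)) x t = 0)
    (hbu0 : ∀ t ∈ Icc 0 T, u 0 t = 0)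
    (hbuℓ : ∀ t ∈ Icc 0 T, u ℓ t = 0)
    (hbm0 : ∀ t ∈ Icc 0 T,
      -(r 0 * pdx (pdx u) 0 t) = -(krm * pdx u 0 t) - kam * pdt (pdx u) 0 t)
    (hbmℓ : ∀ t ∈ Icc 0 T,
      -(r ℓ * pdx (pdx u) ℓ t) = krp * pdx u ℓ t + kap * pdt (pdx u) ℓ t)
    (β₀ β₁ : ℝ)
    (hβ₀ : β₀ = ℓ^2/2 * Real.sqrt (m₁/r₀))
    (hβ₁ : β₁ = β₀ * (1 + 1/Real.sqrt (m₁*r₀) * (ℓ^2*μ₁ + 2/ℓ * (kam + kap)))) :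
    ∀ t ∈ Icc 0 T,
      -β₀ * beamEnergy m r krm krp ℓ u t ≤ beamJ m μ kam kap ℓ u t ∧ beamJ m μ kam kap ℓ u t ≤ β₁ * beamEnergy m r krm krp ℓ u t := by
  intro t ht
  have hm₁ : 0 < m₁ := by
    have := hmb 0 (left_mem_Icc.2 hℓ.le); linarith
  have hμ₁ : 0 ≤ μ₁ := by
    have := hμb 0 (left_mem_Icc.2 hℓ.le); linarith
  have hsec : ContDiff ℝ (⊤ : ℕ∞) fun x => u x t :=
    hu.comp (contDiff_id.prodMk contDiff_const)
  have hsec' : ContDiff ℝ (⊤ : ℕ∞) fun x => pdx u x t :=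
    ((contDiff_infty_iff_deriv (𝕜 := ℝ)).1 hsec).2
  have hsec'' : ContDiff ℝ (⊤ : ℕ∞) fun x => pdx (pdx u) x t :=
    ((contDiff_infty_iff_deriv (𝕜 := ℝ)).1 hsec').2
  have hd : ∀ x, HasDerivAt (fun x => u x t) (pdx u x t) x := fun x =>
    (hsec.differentiable (by simp) x).hasDerivAt
  have hd' : ∀ x, HasDerivAt (fun x => pdx u x t) (pdx (pdx u) x t) x := fun x =>
    (hsec'.differentiable (by simp) x).hasDerivAt
  have hvel : Continuous fun x => pdt u x t := by
    have heq : (fun x => pdt u x t)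
        = fun x => fderiv ℝ (Function.uncurry u) (x, t) ((0 : ℝ), (1 : ℝ)) := by
      ext x
      have hp : HasDerivAt (fun s : ℝ => (x, s)) ((0 : ℝ), (1 : ℝ)) t :=
        (hasDerivAt_const t x).prodMk (hasDerivAt_id t)
      exact ((hu.differentiable (by simp) (x, t)).hasFDerivAt.comp_hasDerivAt t hp).deriv
    rw [heq]
    have := hu.continuous_fderiv (by simp)
    fun_prop
  have hA := integral_sq_le_integral_sq_second_deriv hℓ.le hd hd' hsec''.continuous
    (hbu0 t ht) (hbuℓ t ht)
  have hl := sq_deriv_left_le hℓ hd hd' hsec''.continuous (hbu0 t ht) (hbuℓ t ht)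
  have hr := sq_deriv_right_le hℓ hd hd' hsec''.continuous (hbu0 t ht) (hbuℓ t ht)
  have hβpos : 0 < β₀ := by rw [hβ₀]; positivity
  have hβsq : β₀ ^ 2 = ℓ ^ 4 / 4 * (m₁ / r₀) := by
    rw [hβ₀, mul_pow, Real.sq_sqrt (by positivity)]; ring
  have hβ₁' : β₁ = β₀ + ℓ ^ 2 / (2 * r₀) * (ℓ ^ 2 * μ₁ + 2 / ℓ * (kam + kap)) := by
    have hs : Real.sqrt (m₁ / r₀) * (1 / Real.sqrt (m₁ * r₀)) = 1 / r₀ := by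
      rw [Real.sqrt_div hm₁.le, Real.sqrt_mul hm₁.le]
      have h1 := Real.sqrt_pos.2 hm₁
      have h2 := Real.sqrt_pos.2 hr₀
      field_simp
      rw [Real.sq_sqrt hr₀.le]
    calc β₁ = β₀ + ℓ ^ 2 / 2 * (Real.sqrt (m₁ / r₀) * (1 / Real.sqrt (m₁ * r₀)))
          * (ℓ ^ 2 * μ₁ + 2 / ℓ * (kam + kap)) := by rw [hβ₁, hβ₀]; ring
      _ = _ := by rw [hs]; field_simp
  have hcross := abs_integral_weight_mul_le hℓ.le hβpos hmc
    (fun x hx => ⟨hm₀.le.trans (hmb x hx).1, (hmb x hx).2⟩) hsec.continuous hvel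
  have hu' : uIcc 0 ℓ = Icc 0 ℓ := uIcc_of_le hℓ.le
  have him : IntervalIntegrable (fun x => m x * pdt u x t ^ 2) MeasureTheory.volume 0 ℓ :=
    (hu' ▸ hmc.mul (hvel.pow 2).continuousOn : ContinuousOn _ (uIcc 0 ℓ)).intervalIntegrable
  have hir : IntervalIntegrable (fun x => r x * pdx (pdx u) x t ^ 2)
      MeasureTheory.volume 0 ℓ :=
    (hu' ▸ hrc.mul (hsec''.continuous.pow 2).continuousOn :
      ContinuousOn _ (uIcc 0 ℓ)).intervalIntegrable
  have hiμ : IntervalIntegrable (fun x => μ x * u x t ^ 2) MeasureTheory.volume 0 ℓ :=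
    (hu' ▸ hμc.mul (hsec.continuous.pow 2).continuousOn :
      ContinuousOn _ (uIcc 0 ℓ)).intervalIntegrable
  have hCr : r₀ * (∫ x in (0 : ℝ)..ℓ, pdx (pdx u) x t ^ 2)
      ≤ ∫ x in (0 : ℝ)..ℓ, r x * pdx (pdx u) x t ^ 2 := by
    rw [← integral_const_mul]
    exact integral_mono_on hℓ.le
      (((hsec''.continuous.pow 2).intervalIntegrable _ _).const_mul _) hir
      fun x hx => mul_le_mul_of_nonneg_right (hrb x hx).1 (sq_nonneg _)
  have hμle : (∫ x in (0 : ℝ)..ℓ, μ x * u x t ^ 2)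
      ≤ μ₁ * ∫ x in (0 : ℝ)..ℓ, u x t ^ 2 := by
    rw [← integral_const_mul]
    exact integral_mono_on hℓ.le hiμ
      (((hsec.continuous.pow 2).intervalIntegrable _ _).const_mul _)
      fun x hx => mul_le_mul_of_nonneg_right (hμb x hx).2 (sq_nonneg _)
  have hμnn : 0 ≤ ∫ x in (0 : ℝ)..ℓ, μ x * u x t ^ 2 :=
    integral_nonneg hℓ.le fun x hx => mul_nonneg (hμ₀.trans (hμb x hx).1) (sq_nonneg _)
  have hKnn : 0 ≤ ∫ x in (0 : ℝ)..ℓ, m x * pdt u x t ^ 2 :=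
    integral_nonneg hℓ.le fun x hx => mul_nonneg (hm₀.le.trans (hmb x hx).1) (sq_nonneg _)
  have hCnn : 0 ≤ ∫ x in (0 : ℝ)..ℓ, pdx (pdx u) x t ^ 2 :=
    integral_nonneg hℓ.le fun x _ => sq_nonneg _
  unfold beamEnergy beamJ
  rw [integral_add him hir]
  generalize (∫ x in (0 : ℝ)..ℓ, pdx (pdx u) x t ^ 2) = C at *
  generalize (∫ x in (0 : ℝ)..ℓ, u x t ^ 2) = A at *
  generalize (∫ x in (0 : ℝ)..ℓ, m x * pdt u x t ^ 2) = K at *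
  generalize (∫ x in (0 : ℝ)..ℓ, r x * pdx (pdx u) x t ^ 2) = R at *
  generalize (∫ x in (0 : ℝ)..ℓ, μ x * u x t ^ 2) = M at *
  generalize (∫ x in (0 : ℝ)..ℓ, m x * u x t * pdt u x t) = P at *
  have hbm : 0 ≤ krm * pdx u 0 t ^ 2 := by positivity
  have hbp : 0 ≤ krp * pdx u ℓ t ^ 2 := by positivity
  have ham : 0 ≤ kam * pdx u 0 t ^ 2 := by positivity
  have hap : 0 ≤ kap * pdx u ℓ t ^ 2 := by positivity
  set E := 1 / 2 * (K + R) + 1 / 2 * krm * pdx u 0 t ^ 2 + 1 / 2 * krp * pdx u ℓ t ^ 2 with hE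
  have hKR : 1 / 2 * (K + R) ≤ E := by rw [hE]; linarith
  have hCE : C ≤ 2 / r₀ * E := by
    rw [div_mul_eq_mul_div, le_div_iff₀ hr₀]; linarith
  have hP : |P| ≤ β₀ * E := by
    have h1 : m₁ / (2 * β₀) * A ≤ β₀ / 2 * R := by
      calc m₁ / (2 * β₀) * A ≤ m₁ / (2 * β₀) * (ℓ ^ 4 / 4 * C) := by gcongr
        _ = ℓ ^ 4 / 4 * (m₁ / r₀) / (2 * β₀) * (r₀ * C) := by field_simp
        _ = β₀ / 2 * (r₀ * C) := by rw [← hβsq]; field_simp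
        _ ≤ β₀ / 2 * R := by gcongr
    calc |P| ≤ β₀ * (1 / 2 * (K + R)) := by linarith
      _ ≤ β₀ * E := by gcongr
  rw [abs_le] at hP
  constructor
  · linarith [hP.1]
  · have hEnn : 0 ≤ E := by
      have : 0 ≤ r₀ * C := by positivity
      linarith
    have hM : M ≤ ℓ ^ 4 * μ₁ / (2 * r₀) * E := by
      calc M ≤ μ₁ * (ℓ ^ 4 / 4 * C) := hμle.trans (by gcongr)
        _ ≤ μ₁ * (ℓ ^ 4 / 4 * (2 / r₀ * E)) := by gcongr
        _ = ℓ ^ 4 * μ₁ / (2 * r₀) * E := by field_simp; ring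
    have hMnn : 0 ≤ ℓ ^ 4 * μ₁ / (2 * r₀) * E := by positivity
    have hkm : kam * pdx u 0 t ^ 2 ≤ kam * (ℓ * (2 / r₀ * E)) := by
      gcongr; exact hl.trans (by gcongr)
    have hkp : kap * pdx u ℓ t ^ 2 ≤ kap * (ℓ * (2 / r₀ * E)) := by
      gcongr; exact hr.trans (by gcongr)
    have hsum : β₁ * E = β₀ * E + ℓ ^ 4 * μ₁ / (2 * r₀) * E
        + 1 / 2 * (kam * (ℓ * (2 / r₀ * E))) + 1 / 2 * (kap * (ℓ * (2 / r₀ * E))) := by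
      rw [hβ₁']; field_simp; ring
    rw [hsum]
    linarith [hP.2]
end

section
/- (Inequality (14): fourth-order Poincaré-type inequality.) If v : [0,ℓ] → ℝ is twice continuously differentiable with v(0) = v(ℓ) = 0, then ∫₀^ℓ v(x)² dx ≤ (ℓ⁴/4) ∫₀^ℓ v''(x)² dx. -/
open Set intervalIntegral

/-- A function vanishing at the left endpoint is controlled pointwise by its Dirichlet energy. -/
theorem sq_le_mul_integral_deriv_sq {v : ℝ → ℝ} (hv : ContDiff ℝ 1 v) (hv0 : v 0 = 0)
    {x : ℝ} (hx : 0 < x) : (v x) ^ 2 ≤ x * ∫ t in (0:ℝ)..x, (deriv v t) ^ 2 := by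
  have hc : Continuous (deriv v) := hv.continuous_deriv le_rfl
  have hftc : ∫ t in (0:ℝ)..x, deriv v t = v x := by
    rw [integral_deriv_eq_sub (fun t _ => hv.differentiable one_ne_zero t)
      (hc.intervalIntegrable _ _), hv0, sub_zero]
  have hexp : ∫ t in (0:ℝ)..x, (deriv v t - v x / x) ^ 2 =
      (∫ t in (0:ℝ)..x, (deriv v t) ^ 2) - 2 * (v x / x) * v x + x * (v x / x) ^ 2 := by
    have h : ∀ t, (deriv v t - v x / x) ^ 2 =
        (deriv v t) ^ 2 - 2 * (v x / x) * deriv v t + (v x / x) ^ 2 := fun t => by ring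
    simp_rw [h]
    rw [integral_add (Continuous.intervalIntegrable (by fun_prop) _ _)
        (Continuous.intervalIntegrable (by fun_prop) _ _),
      integral_sub (Continuous.intervalIntegrable (by fun_prop) _ _)
        (Continuous.intervalIntegrable (by fun_prop) _ _),
      integral_const_mul, hftc, integral_const, smul_eq_mul, sub_zero]
  have hnonneg : 0 ≤ ∫ t in (0:ℝ)..x, (deriv v t - v x / x) ^ 2 :=
    integral_nonneg hx.le fun t _ => sq_nonneg _
  rw [hexp] at hnonneg
  have hmul := mul_nonneg hx.le hnonneg
  field_simp at hmul
  linarith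

/-- Poincaré inequality for functions vanishing at the left endpoint. -/
theorem integral_sq_le_integral_deriv_sq {v : ℝ → ℝ} (hv : ContDiff ℝ 1 v) (hv0 : v 0 = 0)
    {ℓ : ℝ} (hℓ : 0 ≤ ℓ) :
    ∫ x in (0:ℝ)..ℓ, (v x) ^ 2 ≤ ℓ ^ 2 / 2 * ∫ x in (0:ℝ)..ℓ, (deriv v x) ^ 2 := by
  have hc : Continuous (deriv v) := hv.continuous_deriv le_rfl
  have hcv : Continuous v := hv.continuous
  calc ∫ x in (0:ℝ)..ℓ, (v x) ^ 2
      ≤ ∫ x in (0:ℝ)..ℓ, x * ∫ t in (0:ℝ)..ℓ, (deriv v t) ^ 2 := by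
        refine integral_mono_on hℓ (Continuous.intervalIntegrable (by fun_prop) _ _)
          (Continuous.intervalIntegrable (by fun_prop) _ _) fun x hx => ?_
        rcases hx.1.eq_or_lt with rfl | hpos
        · simp [hv0]
        · refine (sq_le_mul_integral_deriv_sq hv hv0 hpos).trans
            (mul_le_mul_of_nonneg_left ?_ hpos.le)
          exact integral_mono_interval le_rfl hx.1 hx.2 (.of_forall fun t => sq_nonneg _)
            ((hc.pow 2).intervalIntegrable _ _)
    _ = ℓ ^ 2 / 2 * ∫ x in (0:ℝ)..ℓ, (deriv v x) ^ 2 := by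
        rw [integral_mul_const, integral_id]
        ring

theorem poincare_fourth_order
    (ℓ : ℝ) (v : ℝ → ℝ)
    (hℓ : 0 < ℓ) (hv : ContDiff ℝ 2 v) (hv0 : v 0 = 0) (hvℓ : v ℓ = 0) :
    (∫ x in (0:ℝ)..ℓ, (v x)^2) ≤ ℓ^4/4 * ∫ x in (0:ℝ)..ℓ, (deriv (deriv v) x)^2 := by
  have hv1 : ContDiff ℝ 1 v := hv.of_le one_le_two
  have hd : ContDiff ℝ 1 (deriv v) := hv.deriv'
  have hcv : Continuous v := hv.continuous
  have hc1 : Continuous (deriv v) := hd.continuous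
  have hc2 : Continuous (deriv (deriv v)) := hd.continuous_deriv le_rfl
  have hparts : ∫ x in (0:ℝ)..ℓ, v x * deriv (deriv v) x =
      -∫ x in (0:ℝ)..ℓ, (deriv v x) ^ 2 := by
    rw [integral_mul_deriv_eq_deriv_mul
      (fun x _ => (hv1.differentiable one_ne_zero x).hasDerivAt)
      (fun x _ => (hd.differentiable one_ne_zero x).hasDerivAt)
      (hc1.intervalIntegrable _ _) (hc2.intervalIntegrable _ _), hv0, hvℓ]
    simp [sq]
  have hexp : ∫ x in (0:ℝ)..ℓ, (v x + ℓ ^ 2 / 2 * deriv (deriv v) x) ^ 2 =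
      (∫ x in (0:ℝ)..ℓ, (v x) ^ 2) + ℓ ^ 2 * (∫ x in (0:ℝ)..ℓ, v x * deriv (deriv v) x)
        + ℓ ^ 4 / 4 * ∫ x in (0:ℝ)..ℓ, (deriv (deriv v) x) ^ 2 := by
    have h : ∀ x, (v x + ℓ ^ 2 / 2 * deriv (deriv v) x) ^ 2 =
        (v x) ^ 2 + ℓ ^ 2 * (v x * deriv (deriv v) x)
          + ℓ ^ 4 / 4 * (deriv (deriv v) x) ^ 2 := fun x => by ring
    simp_rw [h]
    rw [integral_add (Continuous.intervalIntegrable (by fun_prop) _ _)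
        (Continuous.intervalIntegrable (by fun_prop) _ _),
      integral_add (Continuous.intervalIntegrable (by fun_prop) _ _)
        (Continuous.intervalIntegrable (by fun_prop) _ _),
      integral_const_mul, integral_const_mul]
  have hnonneg : 0 ≤ ∫ x in (0:ℝ)..ℓ, (v x + ℓ ^ 2 / 2 * deriv (deriv v) x) ^ 2 :=
    integral_nonneg hℓ.le fun x _ => sq_nonneg _
  rw [hexp, hparts] at hnonneg
  linarith [integral_sq_le_integral_deriv_sq hv1 hv0 hℓ.le]
end

section
/- (First-derivative Poincaré-type inequality used in the proof of inequality (14).) If v : [0,ℓ] → ℝ is twice continuously differentiable with v(0) = v(ℓ) = 0, then ∫₀^ℓ v'(x)² dx ≤ (ℓ²/2) ∫₀^ℓ v''(x)² dx. -/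
open Set intervalIntegral

/-- Cauchy–Schwarz inequality against the constant function `1` on `[a, b]`. -/
theorem sq_integral_le_mul_integral_sq {f : ℝ → ℝ} (hf : Continuous f) {a b : ℝ} (hab : a ≤ b) :
    (∫ x in a..b, f x) ^ 2 ≤ (b - a) * ∫ x in a..b, f x ^ 2 := by
  rcases hab.eq_or_lt with rfl | hlt
  · simp
  set I := ∫ x in a..b, f x with hI
  have hnonneg : 0 ≤ ∫ x in a..b, ((b - a) * f x - I) ^ 2 :=
    integral_nonneg hab fun x _ => sq_nonneg _
  have hexpand : ∫ x in a..b, ((b - a) * f x - I) ^ 2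
      = (b - a) * ((b - a) * (∫ x in a..b, f x ^ 2) - I ^ 2) := by
    have hpt : ∀ x, ((b - a) * f x - I) ^ 2
        = (b - a) ^ 2 * f x ^ 2 - 2 * (b - a) * I * f x + I ^ 2 := fun x => by ring
    simp_rw [hpt]
    rw [integral_add (Continuous.intervalIntegrable (by fun_prop) _ _)
        (Continuous.intervalIntegrable (by fun_prop) _ _),
      integral_sub (Continuous.intervalIntegrable (by fun_prop) _ _)
        (Continuous.intervalIntegrable (by fun_prop) _ _),
      integral_const_mul, integral_const_mul, integral_const, ← hI, smul_eq_mul]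
    ring
  rw [hexpand] at hnonneg
  linarith [nonneg_of_mul_nonneg_right hnonneg (sub_pos.mpr hlt)]

/-- A function vanishing at `c ∈ [a, b]` is controlled in `L²` by its derivative. -/
theorem integral_sq_le_of_eq_zero {w : ℝ → ℝ} (hw : ContDiff ℝ 1 w) {a b c : ℝ}
    (hc : c ∈ Icc a b) (hwc : w c = 0) :
    ∫ x in a..b, w x ^ 2 ≤ (b - a) ^ 2 / 2 * ∫ x in a..b, deriv w x ^ 2 := by
  have hw' : Continuous (deriv w) := hw.continuous_deriv le_rfl
  have hwcont : Continuous w := hw.continuous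
  have hftc : ∀ p q, ∫ x in p..q, deriv w x = w q - w p := fun p q =>
    integral_deriv_eq_sub (fun x _ => hw.differentiable one_ne_zero x)
      (hw'.intervalIntegrable _ _)
  set B := ∫ x in a..b, deriv w x ^ 2
  have hB0 : 0 ≤ B := integral_nonneg (hc.1.trans hc.2) fun x _ => sq_nonneg _
  have hmono : ∀ p q, a ≤ p → p ≤ q → q ≤ b → ∫ x in p..q, deriv w x ^ 2 ≤ B :=
    fun p q hp hpq hq => integral_mono_interval hp hpq hq
      (Filter.Eventually.of_forall fun x => sq_nonneg _)
      ((hw'.pow 2).intervalIntegrable _ _)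
  have hleft : ∫ x in a..c, w x ^ 2 ≤ ∫ x in a..c, (c - x) * B := by
    refine integral_mono_on hc.1 ((hwcont.pow 2).intervalIntegrable _ _)
      (Continuous.intervalIntegrable (by fun_prop) _ _) fun x hx => ?_
    have h := sq_integral_le_mul_integral_sq hw' hx.2
    rw [hftc, hwc, zero_sub, neg_sq] at h
    exact h.trans (mul_le_mul_of_nonneg_left (hmono x c hx.1 hx.2 hc.2) (sub_nonneg.mpr hx.2))
  have hright : ∫ x in c..b, w x ^ 2 ≤ ∫ x in c..b, (x - c) * B := by
    refine integral_mono_on hc.2 ((hwcont.pow 2).intervalIntegrable _ _)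
      (Continuous.intervalIntegrable (by fun_prop) _ _) fun x hx => ?_
    have h := sq_integral_le_mul_integral_sq hw' hx.1
    rw [hftc, hwc, sub_zero] at h
    exact h.trans (mul_le_mul_of_nonneg_left (hmono c x hc.1 hx.1 hx.2) (sub_nonneg.mpr hx.1))
  have hIl : ∫ x in a..c, (c - x) * B = (c - a) ^ 2 / 2 * B := by
    rw [integral_mul_const, integral_sub (Continuous.intervalIntegrable (by fun_prop) _ _)
      (Continuous.intervalIntegrable (by fun_prop) _ _), integral_const, integral_id, smul_eq_mul]
    ring
  have hIr : ∫ x in c..b, (x - c) * B = (b - c) ^ 2 / 2 * B := by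
    rw [integral_mul_const, integral_sub (Continuous.intervalIntegrable (by fun_prop) _ _)
      (Continuous.intervalIntegrable (by fun_prop) _ _), integral_const, integral_id, smul_eq_mul]
    ring
  have hsplit : (∫ x in a..c, w x ^ 2) + ∫ x in c..b, w x ^ 2 = ∫ x in a..b, w x ^ 2 :=
    integral_add_adjacent_intervals ((hwcont.pow 2).intervalIntegrable _ _)
      ((hwcont.pow 2).intervalIntegrable _ _)
  have hcross : 0 ≤ (c - a) * (b - c) * B :=
    mul_nonneg (mul_nonneg (sub_nonneg.mpr hc.1) (sub_nonneg.mpr hc.2)) hB0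
  rw [hIl] at hleft
  rw [hIr] at hright
  linarith

theorem poincare_first_derivative
    (ℓ : ℝ) (v : ℝ → ℝ)
    (hℓ : 0 < ℓ) (hv : ContDiff ℝ 2 v) (hv0 : v 0 = 0) (hvℓ : v ℓ = 0) :
    (∫ x in (0:ℝ)..ℓ, (deriv v x)^2) ≤ ℓ^2/2 * ∫ x in (0:ℝ)..ℓ, (deriv (deriv v) x)^2 := by
  obtain ⟨c, hc, hvc⟩ := exists_deriv_eq_zero hℓ hv.continuous.continuousOn (hv0.trans hvℓ.symm)
  have hw : ContDiff ℝ 1 (deriv v) := by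
    have hv' : ContDiff ℝ (1 + 1) v := by simpa [one_add_one_eq_two] using hv
    exact (contDiff_succ_iff_deriv.mp hv').2.2
  simpa using integral_sq_le_of_eq_zero hw (Ioo_subset_Icc_self hc) hvc
end

section
/- (Estimate (15): bound for the cross term.) If v : [0,ℓ] → ℝ is twice continuously differentiable with v(0) = v(ℓ) = 0 and w : [0,ℓ] → ℝ is continuous, then |∫₀^ℓ m(x) v(x) w(x) dx| ≤ (ℓ²/4)√(m₁/r₀) · (∫₀^ℓ m(x) w(x)² dx + ∫₀^ℓ r(x) v''(x)² dx). -/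
open Set intervalIntegral

/-- Squared `L¹` norm bounded by the squared `L²` norm on a bounded interval. -/
lemma sq_integral_abs_le {ℓ : ℝ} (hℓ : 0 < ℓ) {g : ℝ → ℝ} (hg : Continuous g) :
    (∫ x in (0:ℝ)..ℓ, |g x|) ^ 2 ≤ ℓ * ∫ x in (0:ℝ)..ℓ, g x ^ 2 := by
  set M := ∫ x in (0:ℝ)..ℓ, |g x| with hM
  have h0 : 0 ≤ ∫ x in (0:ℝ)..ℓ, (ℓ * |g x| - M) ^ 2 :=
    integral_nonneg hℓ.le fun x _ => sq_nonneg _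
  have h1 : (∫ x in (0:ℝ)..ℓ, (ℓ * |g x| - M) ^ 2)
      = ℓ ^ 2 * (∫ x in (0:ℝ)..ℓ, g x ^ 2) - 2 * ℓ * M * M + M ^ 2 * ℓ := by
    have e : ∀ x, (ℓ * |g x| - M) ^ 2 = ℓ ^ 2 * g x ^ 2 - 2 * ℓ * M * |g x| + M ^ 2 := by
      intro x
      rw [← sq_abs (g x)]
      ring
    simp_rw [e]
    rw [integral_add (Continuous.intervalIntegrable (by fun_prop) _ _)
        (Continuous.intervalIntegrable (by fun_prop) _ _),
      integral_sub (Continuous.intervalIntegrable (by fun_prop) _ _)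
        (Continuous.intervalIntegrable (by fun_prop) _ _),
      integral_const_mul, integral_const_mul, ← hM, integral_const]
    simp only [smul_eq_mul]
    ring
  rw [h1] at h0
  have h2 : 0 ≤ ℓ * (ℓ * (∫ x in (0:ℝ)..ℓ, g x ^ 2) - M ^ 2) := by linarith
  have := nonneg_of_mul_nonneg_right h2 hℓ
  linarith

/-- A `C²` function vanishing at both endpoints is controlled by the `L¹` norm of its second
derivative. -/
lemma abs_le_integral_abs_deriv_deriv {ℓ : ℝ} (hℓ : 0 < ℓ) {v : ℝ → ℝ} (hv : ContDiff ℝ 2 v)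
    (hv0 : v 0 = 0) (hvℓ : v ℓ = 0) {x : ℝ} (hx : x ∈ Icc 0 ℓ) :
    |v x| ≤ ℓ / 2 * ∫ y in (0:ℝ)..ℓ, |deriv (deriv v) y| := by
  set M := ∫ y in (0:ℝ)..ℓ, |deriv (deriv v) y| with hM
  have hd : Differentiable ℝ v := hv.differentiable (by norm_num)
  have hv' : ContDiff ℝ 1 (deriv v) := by
    have : ContDiff ℝ (1 + 1) v := by simpa [one_add_one_eq_two] using hv
    exact (contDiff_succ_iff_deriv.1 this).2.2
  have hd' : Differentiable ℝ (deriv v) := hv'.differentiable (by norm_num)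
  have hc : Continuous (deriv (deriv v)) := hv'.continuous_deriv le_rfl
  obtain ⟨ξ, hξ, hξ0⟩ := exists_deriv_eq_zero hℓ hd.continuous.continuousOn (hv0.trans hvℓ.symm)
  have hbound : ∀ y ∈ Icc 0 ℓ, ‖deriv v y‖ ≤ M := by
    intro y hy
    have hftc : ∫ z in ξ..y, deriv (deriv v) z = deriv v y := by
      rw [integral_deriv_eq_sub (fun z _ => hd' z) (hc.intervalIntegrable _ _), hξ0, sub_zero]
    rw [← hftc]
    refine (norm_integral_le_abs_integral_norm).trans ?_
    refine (abs_integral_mono_interval (c := 0) (d := ℓ) ?_ ?_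
      (hc.norm.intervalIntegrable _ _)).trans (le_of_eq ?_)
    · rw [uIoc_of_le hℓ.le]
      exact Ioc_subset_Ioc (le_min hξ.1.le hy.1) (max_le hξ.2.le hy.2)
    · exact Filter.Eventually.of_forall fun z => norm_nonneg _
    · exact abs_of_nonneg (integral_nonneg hℓ.le fun z _ => norm_nonneg _)
  have h0 := (convex_Icc (0:ℝ) ℓ).norm_image_sub_le_of_norm_deriv_le (fun y _ => hd y) hbound
    (left_mem_Icc.2 hℓ.le) hx
  have h1 := (convex_Icc (0:ℝ) ℓ).norm_image_sub_le_of_norm_deriv_le (fun y _ => hd y) hbound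
    (right_mem_Icc.2 hℓ.le) hx
  rw [hv0, sub_zero, sub_zero, Real.norm_eq_abs, Real.norm_eq_abs, abs_of_nonneg hx.1] at h0
  rw [hvℓ, sub_zero, Real.norm_eq_abs, Real.norm_eq_abs,
    abs_of_nonpos (sub_nonpos.2 hx.2)] at h1
  linarith

theorem cross_term_bound
    (ℓ m₀ m₁ r₀ r₁ : ℝ) (m r : ℝ → ℝ) (v w : ℝ → ℝ)
    (hℓ : 0 < ℓ) (hm₀ : 0 < m₀) (hr₀ : 0 < r₀)
    (hmc : ContinuousOn m (Icc 0 ℓ)) (hrc : ContinuousOn r (Icc 0 ℓ))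
    (hmb : ∀ x ∈ Icc 0 ℓ, m₀ ≤ m x ∧ m x ≤ m₁)
    (hrb : ∀ x ∈ Icc 0 ℓ, r₀ ≤ r x ∧ r x ≤ r₁)
    (hv : ContDiff ℝ 2 v) (hv0 : v 0 = 0) (hvℓ : v ℓ = 0)
    (hw : ContinuousOn w (Icc 0 ℓ)) :
    |∫ x in (0:ℝ)..ℓ, m x * v x * w x|
      ≤ ℓ^2/4 * Real.sqrt (m₁/r₀) *
          ((∫ x in (0:ℝ)..ℓ, m x * (w x)^2)
            + ∫ x in (0:ℝ)..ℓ, r x * (deriv (deriv v) x)^2) := by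
  have hm₁ : 0 < m₁ := by
    have := hmb 0 (left_mem_Icc.2 hℓ.le)
    linarith
  set M := ∫ y in (0:ℝ)..ℓ, |deriv (deriv v) y|
  set c := ℓ^2/4 * Real.sqrt (m₁/r₀) with hc
  have hcpos : 0 < c := by positivity
  have hcsq : 16 * c ^ 2 * r₀ = ℓ ^ 4 * m₁ := by
    rw [hc, mul_pow, Real.sq_sqrt (by positivity)]
    field_simp
    norm_num
  have hvc : Continuous v := hv.continuous
  have hc2 : Continuous (deriv (deriv v)) := by
    have : ContDiff ℝ (1 + 1) v := by simpa [one_add_one_eq_two] using hv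
    exact (contDiff_succ_iff_deriv.1 this).2.2.continuous_deriv le_rfl
  have hCS := sq_integral_abs_le hℓ hc2
  have hii : ∀ f : ℝ → ℝ, ContinuousOn f (Icc 0 ℓ) →
      IntervalIntegrable f MeasureTheory.volume 0 ℓ :=
    fun f hf => ContinuousOn.intervalIntegrable_of_Icc hℓ.le hf
  have hpt : ∀ x ∈ Icc 0 ℓ, |m x * v x * w x| ≤ c * (m x * w x ^ 2) + c * r₀ * M ^ 2 / ℓ ^ 2 := by
    intro x hx
    have hmx : 0 < m x := hm₀.trans_le (hmb x hx).1
    have hvx : v x ^ 2 ≤ (ℓ / 2 * M) ^ 2 := by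
      rw [← sq_abs]
      exact pow_le_pow_left₀ (abs_nonneg _) (abs_le_integral_abs_deriv_deriv hℓ hv hv0 hvℓ hx) 2
    have hmv : m x * v x ^ 2 ≤ m₁ * (ℓ / 2 * M) ^ 2 :=
      mul_le_mul (hmb x hx).2 hvx (sq_nonneg _) hm₁.le
    have hK : c * r₀ * M ^ 2 / ℓ ^ 2 = m₁ * (ℓ / 2 * M) ^ 2 / (4 * c) := by
      field_simp
      linear_combination M ^ 2 * hcsq
    have hAG : |m x * v x * w x| ≤ c * (m x * w x ^ 2) + m x * v x ^ 2 / (4 * c) := by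
      have e : c * (m x * w x ^ 2) + m x * v x ^ 2 / (4 * c) - |m x * v x * w x|
          = m x / (4 * c) * (2 * c * |w x| - |v x|) ^ 2 := by
        rw [abs_mul, abs_mul, abs_of_pos hmx, ← sq_abs (w x), ← sq_abs (v x)]
        field_simp
        ring
      have : 0 ≤ m x / (4 * c) * (2 * c * |w x| - |v x|) ^ 2 := by positivity
      linarith
    rw [hK]
    exact hAG.trans (by gcongr)
  have hr : r₀ * (∫ x in (0:ℝ)..ℓ, deriv (deriv v) x ^ 2)
      ≤ ∫ x in (0:ℝ)..ℓ, r x * deriv (deriv v) x ^ 2 := by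
    rw [← integral_const_mul]
    refine integral_mono_on hℓ.le (hii _ (by fun_prop)) (hii _ (by fun_prop)) fun x hx => ?_
    exact mul_le_mul_of_nonneg_right (hrb x hx).1 (sq_nonneg _)
  calc |∫ x in (0:ℝ)..ℓ, m x * v x * w x|
      ≤ ∫ x in (0:ℝ)..ℓ, |m x * v x * w x| := abs_integral_le_integral_abs hℓ.le
    _ ≤ ∫ x in (0:ℝ)..ℓ, (c * (m x * w x ^ 2) + c * r₀ * M ^ 2 / ℓ ^ 2) :=
        integral_mono_on hℓ.le (hii _ (by fun_prop)) (hii _ (by fun_prop)) hpt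
    _ = c * (∫ x in (0:ℝ)..ℓ, m x * w x ^ 2) + c * r₀ * (M ^ 2 / ℓ) := by
        rw [integral_add (hii _ (by fun_prop)) (hii _ (by fun_prop)), integral_const_mul,
          integral_const, smul_eq_mul]
        field_simp
        ring
    _ ≤ c * (∫ x in (0:ℝ)..ℓ, m x * w x ^ 2)
          + c * r₀ * ∫ x in (0:ℝ)..ℓ, deriv (deriv v) x ^ 2 := by
        gcongr
        rw [div_le_iff₀ hℓ]
        linarith
    _ ≤ _ := by
        rw [mul_add, mul_assoc c r₀]
        gcongr
end

section
/- (Two-sided bound of the Lyapunov function by the energy.) Let β₀ = (ℓ²/2)√(m₁/r₀), β₁ = β₀ · (1 + (1/√(m₁ r₀)) · (ℓ² μ₁ + (2/ℓ)(k_a⁻ + k_a⁺))), and let λ satisfy 0 < λ < 1/β₀. Then for every t ∈ [0,T], (1 − β₀ λ) E(t) ≤ L(t) ≤ (1 + β₁ λ) E(t), where L(t) = E(t) + λ J(t). -/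
open Set intervalIntegral

theorem sq_deriv_le_of_eq_zero_endpoints {w : ℝ → ℝ} (hw : ContDiff ℝ 2 w) {ℓ : ℝ} (hℓ : 0 < ℓ)
    (h0 : w 0 = 0) (h1 : w ℓ = 0) {x : ℝ} (hx : x ∈ Icc 0 ℓ) :
    deriv w x ^ 2 ≤ ℓ * ∫ y in (0:ℝ)..ℓ, deriv (deriv w) y ^ 2 := by
  have hw' : ContDiff ℝ 1 (deriv w) := hw.deriv'
  have hd : Differentiable ℝ (deriv w) := hw'.differentiable one_ne_zero
  have hc : Continuous (deriv (deriv w)) := hw'.continuous_deriv le_rfl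
  obtain ⟨ξ, hξ, hξ0⟩ := exists_deriv_eq_zero hℓ hw.continuous.continuousOn (h0.trans h1.symm)
  have key : ∀ a b, 0 ≤ a → a ≤ b → b ≤ ℓ →
      (deriv w b - deriv w a) ^ 2 ≤ ℓ * ∫ y in (0:ℝ)..ℓ, deriv (deriv w) y ^ 2 := by
    intro a b ha hab hb
    rw [← integral_deriv_eq_sub (fun y _ => hd y) (hc.intervalIntegrable _ _)]
    refine (sq_integral_le_mul_integral_sq hc hab).trans ?_
    have hmono : ∫ y in a..b, deriv (deriv w) y ^ 2 ≤ ∫ y in (0:ℝ)..ℓ, deriv (deriv w) y ^ 2 :=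
      integral_mono_interval ha hab hb (Filter.Eventually.of_forall fun y => sq_nonneg _)
        ((hc.pow 2).intervalIntegrable _ _)
    have hnn : 0 ≤ ∫ y in a..b, deriv (deriv w) y ^ 2 :=
      integral_nonneg hab fun y _ => sq_nonneg _
    exact mul_le_mul (by linarith) hmono hnn hℓ.le
  rcases le_total ξ x with h | h
  · simpa [hξ0] using key ξ x hξ.1.le h hx.2
  · simpa [hξ0] using key x ξ hx.1 h hξ.2.le

theorem sq_le_of_sq_deriv_le {w : ℝ → ℝ} (hw : Differentiable ℝ w) {ℓ K : ℝ}
    (h0 : w 0 = 0) (h1 : w ℓ = 0) (hK : ∀ x ∈ Icc 0 ℓ, deriv w x ^ 2 ≤ K)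
    {x : ℝ} (hx : x ∈ Icc 0 ℓ) : w x ^ 2 ≤ ℓ ^ 2 / 4 * K := by
  have hbound : ∀ y ∈ Icc 0 ℓ, ‖deriv w y‖ ≤ √K := fun y hy => Real.abs_le_sqrt (hK y hy)
  have hK0 : 0 ≤ K := (sq_nonneg _).trans (hK x hx)
  have hℓ : 0 ≤ ℓ := hx.1.trans hx.2
  have mvt : ∀ a ∈ Icc 0 ℓ, ‖w x - w a‖ ≤ √K * ‖x - a‖ := fun a ha =>
    (convex_Icc 0 ℓ).norm_image_sub_le_of_norm_deriv_le (fun y _ => hw y) hbound ha hx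
  have hleft := mvt 0 ⟨le_rfl, hℓ⟩
  have hright := mvt ℓ ⟨hℓ, le_rfl⟩
  rw [h0, sub_zero, sub_zero, Real.norm_eq_abs, Real.norm_eq_abs, abs_of_nonneg hx.1] at hleft
  rw [h1, sub_zero, Real.norm_eq_abs, Real.norm_eq_abs, abs_sub_comm,
    abs_of_nonneg (sub_nonneg.2 hx.2)] at hright
  have habs : |w x| ≤ ℓ / 2 * √K := by linarith
  calc w x ^ 2 = |w x| ^ 2 := (sq_abs _).symm
    _ ≤ (ℓ / 2 * √K) ^ 2 := pow_le_pow_left₀ (abs_nonneg _) habs 2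
    _ = ℓ ^ 2 / 4 * K := by rw [mul_pow, Real.sq_sqrt hK0]; ring

theorem continuous_pdt {u : ℝ → ℝ → ℝ} (hu : ContDiff ℝ 1 (Function.uncurry u)) (t : ℝ) :
    Continuous fun x => pdt u x t := by
  have heq : (fun x => pdt u x t) = fun x => fderiv ℝ (Function.uncurry u) (x, t) (0, 1) := by
    funext x
    have hF := (hu.differentiable one_ne_zero (x, t)).hasFDerivAt
    exact (hF.comp_hasDerivAt t ((hasDerivAt_const t x).prodMk (hasDerivAt_id t))).deriv
  rw [heq]
  exact ((hu.continuous_fderiv one_ne_zero).comp (by fun_prop)).clm_apply continuous_const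

/-- Young's inequality for the kinetic cross term, with one factor bounded uniformly. -/
theorem abs_integral_mul_mul_le {ℓ β m₁ K : ℝ} (hℓ : 0 ≤ ℓ) (hβ : 0 < β) {m w v : ℝ → ℝ}
    (hm : ContinuousOn m (Icc 0 ℓ)) (hv : Continuous v)
    (hm0 : ∀ x ∈ Icc 0 ℓ, 0 ≤ m x) (hm1 : ∀ x ∈ Icc 0 ℓ, m x ≤ m₁)
    (hK : ∀ x ∈ Icc 0 ℓ, w x ^ 2 ≤ K) :
    |∫ x in (0:ℝ)..ℓ, m x * w x * v x|
      ≤ β / 2 * (∫ x in (0:ℝ)..ℓ, m x * v x ^ 2) + ℓ * (m₁ * K / (2 * β)) := by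
  have hmv : IntervalIntegrable (fun x => m x * v x ^ 2) MeasureTheory.volume 0 ℓ :=
    (hm.mul (hv.pow 2).continuousOn).intervalIntegrable_of_Icc hℓ
  have hrhs : ∫ x in (0:ℝ)..ℓ, (β / 2 * (m x * v x ^ 2) + m₁ * K / (2 * β))
      = β / 2 * (∫ x in (0:ℝ)..ℓ, m x * v x ^ 2) + ℓ * (m₁ * K / (2 * β)) := by
    rw [integral_add (hmv.const_mul _) intervalIntegrable_const, integral_const_mul,
      integral_const, smul_eq_mul, sub_zero]
  rw [← hrhs, ← Real.norm_eq_abs]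
  refine norm_integral_le_of_norm_le hℓ (Filter.Eventually.of_forall fun x hx => ?_)
    ((hmv.const_mul _).add intervalIntegrable_const)
  have hx' : x ∈ Icc 0 ℓ := Ioc_subset_Icc_self hx
  have hmw : m x * w x ^ 2 ≤ m₁ * K :=
    mul_le_mul (hm1 x hx') (hK x hx') (sq_nonneg _) ((hm0 x hx').trans (hm1 x hx'))
  have hyoung : |w x * v x| ≤ β / 2 * v x ^ 2 + w x ^ 2 / (2 * β) := by
    rw [← sub_nonneg, abs_mul, ← sq_abs (v x), ← sq_abs (w x)]
    have : β / 2 * |v x| ^ 2 + |w x| ^ 2 / (2 * β) - |w x| * |v x|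
        = (β * |v x| - |w x|) ^ 2 / (2 * β) := by
      field_simp
      ring
    rw [this]
    positivity
  calc ‖m x * w x * v x‖ = m x * |w x * v x| := by
        rw [Real.norm_eq_abs, mul_assoc, abs_mul, abs_of_nonneg (hm0 x hx')]
    _ ≤ m x * (β / 2 * v x ^ 2 + w x ^ 2 / (2 * β)) :=
        mul_le_mul_of_nonneg_left hyoung (hm0 x hx')
    _ = β / 2 * (m x * v x ^ 2) + m x * w x ^ 2 / (2 * β) := by ring
    _ ≤ β / 2 * (m x * v x ^ 2) + m₁ * K / (2 * β) := by gcongr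

theorem lyapunov_two_sided_bound
    (ℓ T m₀ m₁ μ₀ μ₁ r₀ r₁ krm kam krp kap : ℝ)
    (m μ r : ℝ → ℝ) (u : ℝ → ℝ → ℝ)
    (hℓ : 0 < ℓ) (hT : 0 < T)
    (hm₀ : 0 < m₀) (hμ₀ : 0 ≤ μ₀) (hr₀ : 0 < r₀)
    (hmc : ContinuousOn m (Icc 0 ℓ)) (hμc : ContinuousOn μ (Icc 0 ℓ))
    (hrc : ContinuousOn r (Icc 0 ℓ))
    (hmb : ∀ x ∈ Icc 0 ℓ, m₀ ≤ m x ∧ m x ≤ m₁)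
    (hμb : ∀ x ∈ Icc 0 ℓ, μ₀ ≤ μ x ∧ μ x ≤ μ₁)
    (hrb : ∀ x ∈ Icc 0 ℓ, r₀ ≤ r x ∧ r x ≤ r₁)
    (hkrm : 0 ≤ krm) (hkam : 0 ≤ kam) (hkrp : 0 ≤ krp) (hkap : 0 ≤ kap)
    (hu : ContDiff ℝ (⊤ : ℕ∞) (Function.uncurry u))
    (hq : ContDiff ℝ (⊤ : ℕ∞) (Function.uncurry (fun x t => r x * pdx (pdx u) x t)))
    (hpde : ∀ x ∈ Ioo 0 ℓ, ∀ t ∈ Ioo 0 T,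
      m x * pdt (pdt u) x t + μ x * pdt u x t
        + pdx (pdx (fun y s => r y * pdx (pdx u) y s)) x t = 0)
    (hbu0 : ∀ t ∈ Icc 0 T, u 0 t = 0)
    (hbuℓ : ∀ t ∈ Icc 0 T, u ℓ t = 0)
    (hbm0 : ∀ t ∈ Icc 0 T,
      -(r 0 * pdx (pdx u) 0 t) = -(krm * pdx u 0 t) - kam * pdt (pdx u) 0 t)
    (hbmℓ : ∀ t ∈ Icc 0 T,
      -(r ℓ * pdx (pdx u) ℓ t) = krp * pdx u ℓ t + kap * pdt (pdx u) ℓ t)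
    (β₀ β₁ : ℝ)
    (hβ₀ : β₀ = ℓ^2/2 * Real.sqrt (m₁/r₀))
    (hβ₁ : β₁ = β₀ * (1 + 1/Real.sqrt (m₁*r₀) * (ℓ^2*μ₁ + 2/ℓ * (kam + kap))))
    (lam : ℝ) (hlam₁ : 0 < lam) (hlam₂ : lam < 1/β₀) :
    ∀ t ∈ Icc 0 T,
      (1 - β₀ * lam) * beamEnergy m r krm krp ℓ u t ≤ beamEnergy m r krm krp ℓ u t + lam * beamJ m μ kam kap ℓ u t ∧
        beamEnergy m r krm krp ℓ u t + lam * beamJ m μ kam kap ℓ u t ≤ (1 + β₁ * lam) * beamEnergy m r krm krp ℓ u t := by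
  intro t ht
  have hmem0 : (0:ℝ) ∈ Icc 0 ℓ := ⟨le_rfl, hℓ.le⟩
  have hmemℓ : ℓ ∈ Icc 0 ℓ := ⟨hℓ.le, le_rfl⟩
  have hm₁ : 0 < m₁ := hm₀.trans_le ((hmb 0 hmem0).1.trans (hmb 0 hmem0).2)
  have hμ₁ : 0 ≤ μ₁ := hμ₀.trans ((hμb 0 hmem0).1.trans (hμb 0 hmem0).2)
  have hw : ContDiff ℝ 2 (fun x => u x t) :=
    (contDiff_infty.1 hu 2).comp (contDiff_id.prodMk contDiff_const)
  have hv : Continuous fun x => pdt u x t := continuous_pdt (contDiff_infty.1 hu 1) t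
  have hw0 := hbu0 t ht
  have hwℓ := hbuℓ t ht
  have hw2 : Continuous fun x => pdx (pdx u) x t :=
    (show ContDiff ℝ 1 (deriv fun x => u x t) from hw.deriv').continuous_deriv le_rfl
  set B := ∫ x in (0:ℝ)..ℓ, pdx (pdx u) x t ^ 2 with hB
  have hB0 : 0 ≤ B := integral_nonneg hℓ.le fun x _ => sq_nonneg _
  have hslope : ∀ x ∈ Icc 0 ℓ, pdx u x t ^ 2 ≤ ℓ * B := fun x hx =>
    sq_deriv_le_of_eq_zero_endpoints hw hℓ hw0 hwℓ hx
  have hdisp : ∀ x ∈ Icc 0 ℓ, u x t ^ 2 ≤ ℓ ^ 2 / 4 * (ℓ * B) := fun x hx =>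
    sq_le_of_sq_deriv_le (hw.differentiable two_ne_zero) hw0 hwℓ hslope hx
  have hβ₀pos : 0 < β₀ := by rw [hβ₀]; positivity
  have hβ₀sq : β₀ ^ 2 = ℓ ^ 4 / 4 * (m₁ / r₀) := by
    rw [hβ₀, mul_pow, Real.sq_sqrt (by positivity)]; ring
  have hcross := abs_integral_mul_mul_le hℓ.le hβ₀pos hmc hv
    (fun x hx => hm₀.le.trans (hmb x hx).1) (fun x hx => (hmb x hx).2) hdisp
  have hcoef : ℓ * (m₁ * (ℓ ^ 2 / 4 * (ℓ * B)) / (2 * β₀)) = β₀ / 2 * (r₀ * B) := by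
    have : β₀ ^ 2 * r₀ = ℓ ^ 4 / 4 * m₁ := by rw [hβ₀sq]; field_simp
    field_simp
    linear_combination (-4 * B) * this
  rw [hcoef] at hcross
  have hIr : IntervalIntegrable (fun x => r x * pdx (pdx u) x t ^ 2) MeasureTheory.volume 0 ℓ :=
    (hrc.mul (hw2.pow 2).continuousOn).intervalIntegrable_of_Icc hℓ.le
  have hIm : IntervalIntegrable (fun x => m x * pdt u x t ^ 2) MeasureTheory.volume 0 ℓ :=
    (hmc.mul (hv.pow 2).continuousOn).intervalIntegrable_of_Icc hℓ.le
  have hIμ : IntervalIntegrable (fun x => μ x * u x t ^ 2) MeasureTheory.volume 0 ℓ :=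
    (hμc.mul (hw.continuous.pow 2).continuousOn).intervalIntegrable_of_Icc hℓ.le
  have hbend : r₀ * B ≤ ∫ x in (0:ℝ)..ℓ, r x * pdx (pdx u) x t ^ 2 := by
    rw [hB, ← integral_const_mul]
    exact integral_mono_on hℓ.le (((hw2.pow 2).intervalIntegrable _ _).const_mul _) hIr
      fun x hx => mul_le_mul_of_nonneg_right (hrb x hx).1 (sq_nonneg _)
  have hkin : 0 ≤ ∫ x in (0:ℝ)..ℓ, m x * pdt u x t ^ 2 :=
    integral_nonneg hℓ.le fun x hx => mul_nonneg (hm₀.le.trans (hmb x hx).1) (sq_nonneg _)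
  have hdamp0 : 0 ≤ ∫ x in (0:ℝ)..ℓ, μ x * u x t ^ 2 :=
    integral_nonneg hℓ.le fun x hx => mul_nonneg (hμ₀.trans (hμb x hx).1) (sq_nonneg _)
  have hdamp : ∫ x in (0:ℝ)..ℓ, μ x * u x t ^ 2 ≤ ℓ * (μ₁ * (ℓ ^ 2 / 4 * (ℓ * B))) := by
    have := integral_mono_on hℓ.le hIμ
      (intervalIntegrable_const (c := μ₁ * (ℓ ^ 2 / 4 * (ℓ * B)))) fun x hx =>
        mul_le_mul (hμb x hx).2 (hdisp x hx) (sq_nonneg _) hμ₁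
    rwa [integral_const, smul_eq_mul, sub_zero] at this
  generalize hE : beamEnergy m r krm krp ℓ u t = E
  generalize hJ : beamJ m μ kam kap ℓ u t = J
  unfold beamEnergy at hE
  unfold beamJ at hJ
  rw [integral_add hIm hIr] at hE
  have hkm : 0 ≤ krm * pdx u 0 t ^ 2 := by positivity
  have hkp : 0 ≤ krp * pdx u ℓ t ^ 2 := by positivity
  have ham : 0 ≤ kam * pdx u 0 t ^ 2 := by positivity
  have hap : 0 ≤ kap * pdx u ℓ t ^ 2 := by positivity
  have ham' : kam * pdx u 0 t ^ 2 ≤ kam * (ℓ * B) :=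
    mul_le_mul_of_nonneg_left (hslope 0 hmem0) hkam
  have hap' : kap * pdx u ℓ t ^ 2 ≤ kap * (ℓ * B) :=
    mul_le_mul_of_nonneg_left (hslope ℓ hmemℓ) hkap
  obtain ⟨hcl, hcu⟩ := abs_le.1 hcross
  have hmain : β₀ / 2 * (∫ x in (0:ℝ)..ℓ, m x * pdt u x t ^ 2) + β₀ / 2 * (r₀ * B) ≤ β₀ * E := by
    rw [← mul_add, div_mul_eq_mul_div, mul_div_assoc]
    exact mul_le_mul_of_nonneg_left (by linarith) hβ₀pos.le
  have hlow : -(β₀ * E) ≤ J := by linarith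
  have hBE : B ≤ 2 * E / r₀ := by
    rw [le_div_iff₀ hr₀]
    linarith
  have hβ₁' : β₁ = β₀ + ℓ ^ 2 / (2 * r₀) * (ℓ ^ 2 * μ₁ + 2 / ℓ * (kam + kap)) := by
    have hratio : β₀ * (1 / √(m₁ * r₀)) = ℓ ^ 2 / (2 * r₀) := by
      have hsm : √m₁ ≠ 0 := (Real.sqrt_pos.2 hm₁).ne'
      rw [hβ₀, Real.sqrt_div hm₁.le, Real.sqrt_mul hm₁.le]
      nth_rewrite 3 [← Real.sq_sqrt hr₀.le]
      field_simp
    rw [hβ₁, ← hratio]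
    ring
  have hrB : 0 ≤ r₀ * B := by positivity
  have hE0 : 0 ≤ E := by linarith
  have hup : J ≤ β₁ * E := by
    have hextra : (ℓ ^ 4 * μ₁ / 8 + ℓ / 2 * (kam + kap)) * B
        ≤ (ℓ ^ 4 * μ₁ / 8 + ℓ / 2 * (kam + kap)) * (2 * E / r₀) :=
      mul_le_mul_of_nonneg_left hBE (by positivity)
    have hexpand : β₁ * E = β₀ * E + (ℓ ^ 4 * μ₁ / 8 + ℓ / 2 * (kam + kap)) * (2 * E / r₀)
        + ℓ ^ 4 * μ₁ / (4 * r₀) * E := by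
      rw [hβ₁']
      field_simp
      ring
    have hslack : 0 ≤ ℓ ^ 4 * μ₁ / (4 * r₀) * E := by positivity
    linarith
  have hlow' := mul_le_mul_of_nonneg_left hlow hlam₁.le
  have hup' := mul_le_mul_of_nonneg_left hup hlam₁.le
  constructor <;> linarith
end
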